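/- For every w ∈ W, there exist w₁ ∈ W^J and v ∈ W_{I(J,δ;w₁)} such that w →_{J,δ} w₁ v. -/

import Mathlib

namespace HePaper

variable {I : Type*} {M : CoxeterMatrix I} {W : Type*} [Group W]

/-- The standard parabolic subgroup `W_J` generated by the simple reflections `s_j`, `j ∈ J`. -/
def parabolic (cs : CoxeterSystem M W) (J : Set I) : Subgroup W :=
  Subgroup.closure (cs.simple '' J)

/-- `W^J`, the set of minimal length coset representatives for `W/W_J`. -/
def minRight (cs : CoxeterSystem M W) (J : Set I) : Set W :=
  {w : W | ∀ j ∈ J, cs.length w < cs.length (w * cs.simple j)}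

/-- `^J W`, the set of minimal length coset representatives for `W_J\W`. -/
def minLeft (cs : CoxeterSystem M W) (J : Set I) : Set W :=
  {w : W | ∀ j ∈ J, cs.length w < cs.length (cs.simple j * w)}

/-- `Ad(u)(K) = {k ∈ I : s_k = u s_j u⁻¹ for some j ∈ K}`. -/
def AdSet (cs : CoxeterSystem M W) (u : W) (K : Set I) : Set I :=
  {k : I | ∃ j ∈ K, cs.simple k = u * cs.simple j * u⁻¹}

/-- Membership in the set `T(J, δ)` of sequences `(J_n, w_n)_{n ≥ 0}`. -/
def InT (cs : CoxeterSystem M W) (J : Set I) (δ : I ≃ I)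
    (Jseq : ℕ → Set I) (wseq : ℕ → W) : Prop :=
  Jseq 0 = J ∧
  (∀ n : ℕ, Jseq (n + 1) = Jseq n ∩ AdSet cs (wseq n) (δ '' Jseq n)) ∧
  (∀ n : ℕ, wseq n ∈ minLeft cs (Jseq n) ∩ minRight cs (δ '' Jseq n)) ∧
  (∀ n : ℕ, ∃ x ∈ parabolic cs (Jseq (n + 1)), ∃ y ∈ parabolic cs (δ '' Jseq n),
      wseq (n + 1) = x * wseq n * y)

/-- `I(J, δ; w)`: the largest subset `K ⊆ J` with `Ad(w)(K) = δ(K)`. -/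
def IJdw (cs : CoxeterSystem M W) (J : Set I) (δ : I ≃ I) (w : W) : Set I :=
  ⋃₀ {K : Set I | K ⊆ J ∧ AdSet cs w K = δ '' K}

/-- The orbit of `w` under the `W_J`-action `x · y = δ(x) y x⁻¹`. -/
def orbit (cs : CoxeterSystem M W) (J : Set I) (δW : W ≃* W) (w : W) : Set W :=
  {y : W | ∃ x ∈ parabolic cs J, y = δW x * w * x⁻¹}

/-- The set of elements of minimal length in the orbit of `w`. -/
def orbitMin (cs : CoxeterSystem M W) (J : Set I) (δW : W ≃* W) (w : W) : Set W :=
  {v ∈ orbit cs J δW w | ∀ u ∈ orbit cs J δW w, cs.length v ≤ cs.length u}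

/-- `w →_{s_j} w'` for some `j ∈ J`: `w' = s_{δ(j)} w s_j` and `ℓ(w') ≤ ℓ(w)`. -/
def stepTo (cs : CoxeterSystem M W) (J : Set I) (δ : I ≃ I) (w w' : W) : Prop :=
  ∃ j ∈ J, w' = cs.simple (δ j) * w * cs.simple j ∧ cs.length w' ≤ cs.length w

/-- `w →_{J,δ} w'`. -/
def toRel (cs : CoxeterSystem M W) (J : Set I) (δ : I ≃ I) : W → W → Prop :=
  Relation.ReflTransGen (stepTo cs J δ)

/-- `w` and `w'` are elementarily strongly `(J, δ)`-conjugate. -/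
def ElemStrong (cs : CoxeterSystem M W) (J : Set I) (δW : W ≃* W) (w w' : W) : Prop :=
  cs.length w = cs.length w' ∧
  ∃ x ∈ parabolic cs J, w' = δW x * w * x⁻¹ ∧
    (cs.length (δW x * w) = cs.length x + cs.length w ∨
     cs.length (w * x⁻¹) = cs.length x + cs.length w)

/-- `w ∼_{J,δ} w'`: strongly `(J, δ)`-conjugate. -/
def simRel (cs : CoxeterSystem M W) (J : Set I) (δW : W ≃* W) : W → W → Prop :=
  Relation.ReflTransGen (ElemStrong cs J δW)

/-- The Bruhat order on `W`: some reduced word for `w` contains a subword that is a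
reduced word for `u`. -/
def bruhatLE (cs : CoxeterSystem M W) (u w : W) : Prop :=
  ∃ ω : List I, cs.wordProd ω = w ∧ cs.IsReduced ω ∧
    ∃ ω' : List I, ω'.Sublist ω ∧ cs.wordProd ω' = u ∧ cs.IsReduced ω'

/-- `supp(w)`: the smallest subset `K ⊆ I` with `w ∈ W_K`. -/
def supp (cs : CoxeterSystem M W) (w : W) : Set I :=
  ⋂₀ {K : Set I | w ∈ parabolic cs K}

/-- `supp_δ(w)`: the smallest `δ`-stable subset of `I` containing `supp(w)`. -/
def suppDelta (cs : CoxeterSystem M W) (δ : I ≃ I) (w : W) : Set I :=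
  ⋃ n : ℕ, (⇑δ)^[n] '' supp cs w

/-- `w ≤_{J,δ} w'` for `w, w' ∈ W^J`. -/
def leJd (cs : CoxeterSystem M W) (J : Set I) (δW : W ≃* W) (w w' : W) : Prop :=
  ∀ v' ∈ orbitMin cs J δW w', ∃ v ∈ orbitMin cs J δW w, bruhatLE cs v v'


section Geometric

/-! ### The geometric representation and injectivity of `i ↦ s_i` -/

open Module Polynomial.Chebyshev

/-- Vanishing of the coefficients in the formula for powers of a product of two reflections whose
product is a rotation of order `m`. -/
theorem reflection_mul_reflection_pow_eq_one {V : Type*} [AddCommGroup V] [Module ℝ V]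
    {x y : V} {f g : Dual ℝ V} (hf : f x = 2) (hg : g y = 2) {m : ℕ} (hm : 2 ≤ m)
    (hfy : f y = -(2 * Real.cos (Real.pi / m))) (hgx : g x = -(2 * Real.cos (Real.pi / m))) :
    (reflection hf * reflection hg) ^ m = 1 := by
  ext z
  rw [LinearEquiv.coe_one, id_eq]
  obtain rfl | hm3 := hm.eq_or_lt
  · have hfy0 : f y = 0 := by simp [hfy]
    have hgx0 : g x = 0 := by simp [hgx]
    simp only [pow_two, LinearEquiv.mul_apply, reflection_apply, map_sub, map_smul, hf, hg,
      hfy0, hgx0]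
    module
  set φ : ℝ := 2 * (Real.pi / m) with hφ
  have hm0 : (0 : ℝ) < m := by positivity
  have hmφ : (m : ℝ) * φ = 2 * Real.pi := by rw [hφ]; field_simp
  have hsin : Real.sin φ ≠ 0 := by
    refine (Real.sin_pos_of_pos_of_lt_pi (by positivity) ?_).ne'
    have h3 : (3 : ℝ) ≤ m := by exact_mod_cast hm3
    nlinarith [Real.pi_pos]
  have ht : 2 * Real.cos φ = f y * g x - 2 := by
    rw [hfy, hgx, hφ, Real.cos_two_mul]; ring
  rw [reflection_mul_reflection_pow_apply hf hg m z (2 * Real.cos φ) ht]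
  have hS : ∀ n : ℤ, (S ℝ n).eval (2 * Real.cos φ) * Real.sin φ = Real.sin ((n + 1) * φ) :=
    fun n => S_two_mul_real_cos φ n
  obtain ⟨k, rfl | rfl⟩ := m.even_or_odd'
  · have h0 : (S ℝ ((k : ℤ) - 1)).eval (2 * Real.cos φ) = 0 := by
      have hk : (k : ℝ) * φ = Real.pi := by push_cast at hmφ; linarith
      have := hS ((k : ℤ) - 1)
      push_cast at this
      rw [sub_add_cancel, hk, Real.sin_pi] at this
      exact (mul_eq_zero.mp this).resolve_right hsin
    rw [show (((2 * k : ℕ) : ℤ) - 2) / 2 = (k : ℤ) - 1 by omega,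
      show (((2 * k : ℕ) : ℤ) - 1) / 2 = (k : ℤ) - 1 by omega, h0]
    simp
  · have h0 : (S ℝ (k : ℤ)).eval (2 * Real.cos φ)
        + (S ℝ ((k : ℤ) - 1)).eval (2 * Real.cos φ) = 0 := by
      have hk : ((k : ℝ) + 1) * φ = 2 * Real.pi - k * φ := by push_cast at hmφ; linarith
      have h1 := hS k
      have h2 := hS ((k : ℤ) - 1)
      push_cast at h1 h2
      rw [hk, Real.sin_two_pi_sub] at h1
      rw [sub_add_cancel] at h2
      refine (mul_eq_zero.mp ?_).resolve_right hsin
      rw [add_mul, h1, h2, neg_add_cancel]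
    rw [show (((2 * k + 1 : ℕ) : ℤ) - 2) / 2 = (k : ℤ) - 1 by omega,
      show (((2 * k + 1 : ℕ) : ℤ) - 1) / 2 = (k : ℤ) by omega,
      show (((2 * k + 1 : ℕ) : ℤ) - 3) / 2 = (k : ℤ) - 1 by omega,
      show ((2 * k + 1 : ℕ) : ℤ) / 2 = (k : ℤ) by omega, h0]
    simp

/-- The simple coroot of the geometric representation on finitely supported functions. -/
noncomputable def simpleCoroot (M : CoxeterMatrix I) (i : I) : Dual ℝ (I →₀ ℝ) :=
  Finsupp.linearCombination ℝ fun j => -(2 * Real.cos (Real.pi / M i j))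

theorem simpleCoroot_single (M : CoxeterMatrix I) (i j : I) :
    simpleCoroot M i (Finsupp.single j 1) = -(2 * Real.cos (Real.pi / M i j)) := by
  simp [simpleCoroot]

theorem simpleCoroot_single_self (M : CoxeterMatrix I) (i : I) :
    simpleCoroot M i (Finsupp.single i 1) = 2 := by
  simp [simpleCoroot_single]

theorem isLiftable_reflection (M : CoxeterMatrix I) :
    M.IsLiftable fun i => reflection (simpleCoroot_single_self M i) := by
  intro i j
  obtain rfl | hij := eq_or_ne i j
  · ext1 z
    simp [involutive_reflection (simpleCoroot_single_self M i) z, LinearEquiv.mul_apply]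
  obtain h0 | h0 := eq_or_ne (M i j) 0
  · simp [h0]
  refine reflection_mul_reflection_pow_eq_one _ _ ?_ (simpleCoroot_single M i j) ?_
  · have := M.off_diagonal i j hij
    omega
  · rw [simpleCoroot_single, M.symmetric j i]

theorem simple_injective (cs : CoxeterSystem M W) : Function.Injective cs.simple := by
  intro i j hij
  by_contra hne
  have h := congrArg (cs.lift ⟨_, isLiftable_reflection M⟩) hij
  rw [cs.lift_apply_simple, cs.lift_apply_simple] at h
  have h' := congrArg (fun e : (I →₀ ℝ) ≃ₗ[ℝ] (I →₀ ℝ) => e (Finsupp.single i 1) i) h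
  simp [reflection_apply, Ne.symm hne] at h'
  norm_num at h'

end Geometric

/-! ### Parity of inversion sequences and the exchange condition -/

section Exchange

open CoxeterSystem

theorem functionEnd_mul_apply {α : Type*} (f g : Function.End α) (a : α) :
    (f * g) a = f (g a) := rfl

open Classical in
/-- The action of a simple reflection on `W × ℤ/2` recording inversions by their parity. -/
noncomputable def parityStep (cs : CoxeterSystem M W) (i : I) : Function.End (W × ZMod 2) :=
  fun p => (cs.simple i * p.1 * cs.simple i, p.2 + if p.1 = cs.simple i then 1 else 0)

open Classical in
theorem parityStep_mul_pow (cs : CoxeterSystem M W) (i j : I) (n : ℕ) (p : W × ZMod 2) :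
    ((parityStep cs i * parityStep cs j) ^ n : Function.End (W × ZMod 2)) p =
      ((cs.simple i * cs.simple j) ^ n * p.1 * ((cs.simple i * cs.simple j) ^ n)⁻¹,
        p.2 + ∑ k ∈ Finset.range (2 * n),
          if p.1 = ((cs.simple i * cs.simple j) ^ k)⁻¹ * cs.simple j then 1 else 0) := by
  induction n with
  | zero => simp [Function.End.one_def]
  | succ n ih =>
    have hrs : ∀ k : ℕ, cs.simple j * (cs.simple i * cs.simple j) ^ k =
        ((cs.simple i * cs.simple j) ^ k)⁻¹ * cs.simple j := by
      intro k
      induction k with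
      | zero => simp
      | succ k ihk =>
        rw [pow_succ, ← mul_assoc, ihk, ← pow_succ, pow_succ']
        simp [mul_assoc]
    set r := cs.simple i * cs.simple j with hr
    have hA : ∀ t : W, r ^ n * t * (r ^ n)⁻¹ = cs.simple j ↔
        t = (r ^ (2 * n))⁻¹ * cs.simple j := by
      intro t
      rw [mul_inv_eq_iff_eq_mul, hrs, ← eq_inv_mul_iff_mul_eq, two_mul, pow_add, mul_inv_rev,
        mul_assoc]
    have hB : ∀ t : W, cs.simple j * (r ^ n * t * (r ^ n)⁻¹) * cs.simple j = cs.simple i ↔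
        t = (r ^ (2 * n + 1))⁻¹ * cs.simple j := by
      intro t
      have h1 : cs.simple i = cs.simple j * (r⁻¹ * cs.simple j) * cs.simple j := by
        simp [hr, mul_assoc]
      rw [h1, mul_left_inj, mul_right_inj, mul_inv_eq_iff_eq_mul, mul_assoc, hrs,
        ← eq_inv_mul_iff_mul_eq]
      have h2 : (r ^ (2 * n + 1))⁻¹ = (r ^ n)⁻¹ * (r⁻¹ * (r ^ n)⁻¹) := by
        rw [← mul_inv_rev, ← mul_inv_rev, ← pow_succ, ← pow_add]
        congr 2
        omega
      rw [h2]
      simp only [mul_assoc]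
    rw [pow_succ', functionEnd_mul_apply, ih, functionEnd_mul_apply]
    simp only [parityStep, hA, hB]
    rw [show 2 * (n + 1) = 2 * n + 1 + 1 by ring, Finset.sum_range_succ, Finset.sum_range_succ]
    refine Prod.ext ?_ ?_
    · simp [hr, pow_succ', mul_assoc]
    · simp only [add_assoc]

theorem isLiftable_parityStep (cs : CoxeterSystem M W) : M.IsLiftable (parityStep cs) := by
  classical
  intro i j
  funext p
  rw [parityStep_mul_pow, cs.simple_mul_simple_pow, two_mul, Finset.sum_range_add]
  simp only [pow_add, cs.simple_mul_simple_pow, one_mul, inv_one, mul_one]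
  rw [CharTwo.add_self_eq_zero, add_zero]
  rfl

open Classical in
theorem lift_parityStep_wordProd (cs : CoxeterSystem M W) (ω : List I) (p : W × ZMod 2) :
    cs.lift ⟨_, isLiftable_parityStep cs⟩ (cs.wordProd ω) p =
      (cs.wordProd ω * p.1 * (cs.wordProd ω)⁻¹,
        p.2 + ((cs.rightInvSeq ω).count p.1 : ZMod 2)) := by
  induction ω with
  | nil => simp [Function.End.one_def]
  | cons i ω ih =>
    rw [cs.wordProd_cons, map_mul, functionEnd_mul_apply, ih,
      cs.lift_apply_simple, rightInvSeq, List.count_cons]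
    have h : cs.wordProd ω * p.1 * (cs.wordProd ω)⁻¹ = cs.simple i ↔
        (cs.wordProd ω)⁻¹ * cs.simple i * cs.wordProd ω = p.1 := by
      rw [mul_inv_eq_iff_eq_mul, ← eq_inv_mul_iff_mul_eq, mul_assoc]
      exact eq_comm
    simp only [parityStep, h, beq_iff_eq]
    refine Prod.ext ?_ ?_
    · simp [mul_assoc]
    · push_cast
      simp only [add_assoc]

open Classical in
theorem count_rightInvSeq_eq (cs : CoxeterSystem M W) {ω ω' : List I}
    (h : cs.wordProd ω = cs.wordProd ω') (t : W) :
    ((cs.rightInvSeq ω).count t : ZMod 2) = (cs.rightInvSeq ω').count t := by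
  have h1 := lift_parityStep_wordProd cs ω (t, 0)
  rw [h, lift_parityStep_wordProd] at h1
  simpa using (congrArg Prod.snd h1).symm

/-- A right descent of the product of a word lies in the right inversion sequence of the word. -/
theorem simple_mem_rightInvSeq (cs : CoxeterSystem M W) (ω : List I) (i : I)
    (h : cs.length (cs.wordProd ω * cs.simple i) < cs.length (cs.wordProd ω)) :
    cs.simple i ∈ cs.rightInvSeq ω := by
  classical
  obtain ⟨ω', hω', he⟩ := cs.exists_isReduced (cs.wordProd ω * cs.simple i)
  have hprod : cs.wordProd (ω'.concat i) = cs.wordProd ω := by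
    rw [cs.wordProd_concat, ← he, cs.simple_mul_simple_cancel_right]
  have hred : cs.IsReduced (ω'.concat i) := by
    have h1 : cs.length (cs.wordProd (ω'.concat i)) ≤ (ω'.concat i).length :=
      cs.length_wordProd_le _
    have h2 := hω'.eq
    rw [← he] at h2
    refine le_antisymm h1 ?_
    rw [hprod, List.length_concat]
    omega
  have hcount : (cs.rightInvSeq (ω'.concat i)).count (cs.simple i) = 1 :=
    List.count_eq_one_of_mem hred.nodup_rightInvSeq (by
      rw [cs.rightInvSeq_concat, List.concat_eq_append]
      simp)
  have hpar := count_rightInvSeq_eq cs hprod (cs.simple i)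
  by_contra hmem
  rw [hcount, List.count_eq_zero_of_not_mem hmem] at hpar
  simp at hpar

theorem rightInvSeq_append (cs : CoxeterSystem M W) (ω ω' : List I) :
    cs.rightInvSeq (ω ++ ω') =
      (cs.rightInvSeq ω).map (fun t => (cs.wordProd ω')⁻¹ * t * cs.wordProd ω')
        ++ cs.rightInvSeq ω' := by
  induction ω with
  | nil => simp
  | cons i ω ih => simp [rightInvSeq, ih, cs.wordProd_append, mul_assoc]

end Exchange

/-! ### Parabolic subgroups and coset representatives -/

theorem simple_mem_parabolic (cs : CoxeterSystem M W) {K : Set I} {k : I} (hk : k ∈ K) :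
    cs.simple k ∈ parabolic cs K :=
  Subgroup.subset_closure ⟨k, hk, rfl⟩

theorem parabolic_mono (cs : CoxeterSystem M W) {K L : Set I} (h : K ⊆ L) :
    parabolic cs K ≤ parabolic cs L :=
  Subgroup.closure_mono (Set.image_mono h)

theorem wordProd_mem_parabolic (cs : CoxeterSystem M W) {K : Set I} {ω : List I}
    (h : ∀ k ∈ ω, k ∈ K) : cs.wordProd ω ∈ parabolic cs K := by
  induction ω with
  | nil => simp [one_mem]
  | cons i ω ih =>
    rw [cs.wordProd_cons]
    exact mul_mem (simple_mem_parabolic cs (h i (by simp))) (ih fun k hk => h k (by simp [hk]))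

theorem mem_parabolic_of_mem_rightInvSeq (cs : CoxeterSystem M W) {K : Set I} {ω : List I}
    (h : ∀ k ∈ ω, k ∈ K) {t : W} (ht : t ∈ cs.rightInvSeq ω) : t ∈ parabolic cs K := by
  induction ω with
  | nil => simp at ht
  | cons i ω ih =>
    have hω : ∀ k ∈ ω, k ∈ K := fun k hk => h k (by simp [hk])
    rw [CoxeterSystem.rightInvSeq, List.mem_cons] at ht
    obtain rfl | ht := ht
    · have := wordProd_mem_parabolic cs hω
      exact mul_mem (mul_mem (inv_mem this) (simple_mem_parabolic cs (h i (by simp)))) this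
    · exact ih hω ht

/-- Elements of `W_K` have reduced words with letters in `K`. -/
theorem exists_isReduced_of_mem_parabolic (cs : CoxeterSystem M W) {K : Set I} {w : W}
    (hw : w ∈ parabolic cs K) :
    ∃ ω : List I, cs.IsReduced ω ∧ (∀ k ∈ ω, k ∈ K) ∧ w = cs.wordProd ω := by
  have step : ∀ (x : W) (k : I), k ∈ K →
      (∃ ω : List I, cs.IsReduced ω ∧ (∀ k ∈ ω, k ∈ K) ∧ x = cs.wordProd ω) →
      ∃ ω : List I, cs.IsReduced ω ∧ (∀ k ∈ ω, k ∈ K) ∧ x * cs.simple k = cs.wordProd ω := by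
    rintro _ k hk ⟨ω, hω, hωK, rfl⟩
    have hlen := hω.eq
    obtain h | h := cs.length_mul_simple (cs.wordProd ω) k
    · refine ⟨ω.concat k, ?_, ?_, (cs.wordProd_concat k ω).symm⟩
      · rw [CoxeterSystem.IsReduced, cs.wordProd_concat, h, hlen, List.length_concat]
      · simp only [List.concat_eq_append, List.mem_append, List.mem_singleton]
        rintro l (hl | rfl)
        · exact hωK l hl
        · exact hk
    · have hmem := simple_mem_rightInvSeq cs ω k (by omega)
      obtain ⟨n, hn, hget⟩ := List.mem_iff_getElem.mp hmem
      have hprod := cs.wordProd_mul_getD_rightInvSeq ω n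
      rw [List.getD_eq_getElem _ _ hn, hget] at hprod
      rw [cs.length_rightInvSeq] at hn
      refine ⟨ω.eraseIdx n, ?_, fun l hl => hωK l (List.mem_of_mem_eraseIdx hl), hprod⟩
      rw [CoxeterSystem.IsReduced, ← hprod, List.length_eraseIdx_of_lt hn]
      omega
  induction hw using Subgroup.closure_induction_right with
  | one => exact ⟨[], by simp [CoxeterSystem.IsReduced], by simp, by simp⟩
  | mul_right x hx y hy ih =>
    obtain ⟨k, hk, rfl⟩ := hy
    exact step x k hk ih
  | mul_inv_cancel x hx y hy ih =>
    obtain ⟨k, hk, rfl⟩ := hy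
    rw [cs.inv_simple]
    exact step x k hk ih

/-- The exchange condition for a product `a * b`: a right descent of `a * b` either is a right
descent of `b`, or its conjugate by `b` is a right inversion of `a` lying in any standard parabolic
subgroup that contains `a`. -/
theorem exchange_mul (cs : CoxeterSystem M W) {K : Set I} {a : W} (ha : a ∈ parabolic cs K)
    (b : W) (i : I) (h : cs.length (a * b * cs.simple i) < cs.length (a * b)) :
    cs.length (b * cs.simple i) < cs.length b ∨
      (cs.length (a * (b * cs.simple i * b⁻¹)) < cs.length a ∧
        b * cs.simple i * b⁻¹ ∈ parabolic cs K) := by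
  obtain ⟨α, hα, hαK, rfl⟩ := exists_isReduced_of_mem_parabolic cs ha
  obtain ⟨β, hβ, rfl⟩ := cs.exists_isReduced b
  rw [← cs.wordProd_append] at h
  have hmem := simple_mem_rightInvSeq cs _ i h
  rw [rightInvSeq_append, List.mem_append, List.mem_map] at hmem
  obtain ⟨t, ht, hti⟩ | hmem := hmem
  · right
    have : cs.wordProd β * cs.simple i * (cs.wordProd β)⁻¹ = t := by
      rw [← hti]; group
    rw [this]
    exact ⟨(cs.isRightInversion_of_mem_rightInvSeq hα ht).2,
      mem_parabolic_of_mem_rightInvSeq cs hαK ht⟩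
  · exact Or.inl (cs.isRightInversion_of_mem_rightInvSeq hβ hmem).2

/-- Left-handed form of the exchange condition for a product. -/
theorem exchange_mul_left (cs : CoxeterSystem M W) (a b : W) (i : I)
    (h : cs.length (cs.simple i * a * b) < cs.length (a * b)) :
    cs.length (cs.simple i * a) < cs.length a ∨
      cs.length (a⁻¹ * cs.simple i * a * b) < cs.length b := by
  have hb : b⁻¹ ∈ parabolic cs Set.univ := by
    simp [parabolic, cs.subgroup_closure_range_simple]
  have := exchange_mul cs hb a⁻¹ i (by
    rw [← cs.length_inv, ← cs.length_inv (b⁻¹ * a⁻¹)]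
    simpa [mul_assoc] using h)
  rw [← cs.length_inv, ← cs.length_inv a⁻¹, ← cs.length_inv (b⁻¹ * _), ← cs.length_inv b⁻¹] at this
  simpa [mul_assoc] using Or.imp_right And.left this

/-- Lengths are additive for the product of an element of `W_K` and a minimal element of a coset of
`W_K`. -/
theorem length_mul_of_minimal (cs : CoxeterSystem M W) {K : Set I} {y : W}
    (hy : ∀ u ∈ parabolic cs K, cs.length y ≤ cs.length (u * y)) {u : W}
    (hu : u ∈ parabolic cs K) : cs.length (u * y) = cs.length u + cs.length y := by
  obtain ⟨ω, hω, hωK, rfl⟩ := exists_isReduced_of_mem_parabolic cs hu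
  clear hu
  induction ω with
  | nil => simp
  | cons i ω ih =>
    have hred : cs.IsReduced ω := hω.drop 1
    have hωK' : ∀ k ∈ ω, k ∈ K := fun k hk => hωK k (by simp [hk])
    have h := ih hred hωK'
    have hi := hω.eq
    have h' := hred.eq
    rw [List.length_cons, cs.wordProd_cons] at hi
    rw [cs.wordProd_cons]
    have hmem := wordProd_mem_parabolic cs hωK'
    obtain hl | hl := cs.length_simple_mul (cs.wordProd ω * y) i
    · rw [mul_assoc, hl]
      omega
    · rw [← mul_assoc] at hl
      obtain h1 | h1 := exchange_mul_left cs (cs.wordProd ω) y i (by omega)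
      · omega
      · have := hy _ (mul_mem (mul_mem (inv_mem hmem)
          (simple_mem_parabolic cs (hωK i (by simp)))) hmem)
        omega

theorem exists_simple_of_length_eq_one (cs : CoxeterSystem M W) {K : Set I} {c : W}
    (hc : c ∈ parabolic cs K) (h1 : cs.length c = 1) : ∃ k ∈ K, c = cs.simple k := by
  obtain ⟨ω, hω, hωK, rfl⟩ := exists_isReduced_of_mem_parabolic cs hc
  rw [hω.eq, List.length_eq_one_iff] at h1
  obtain ⟨k, rfl⟩ := h1
  exact ⟨k, hωK k (by simp), by simp⟩

/-- If `x` is minimal in `W_K x` and has no right descent in `J`, then `d * x` with `d ∈ W_K` lies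
in `W^J` as soon as it has no right descent among those `j ∈ J` for which `x s_j x⁻¹` is a simple
reflection of `W_K`. -/
theorem mul_mem_minRight (cs : CoxeterSystem M W) {J K : Set I} {x d : W}
    (hxK : ∀ u ∈ parabolic cs K, cs.length x ≤ cs.length (u * x)) (hxJ : x ∈ minRight cs J)
    (hd : d ∈ parabolic cs K)
    (h : d * x ∈ minRight cs {j ∈ J | ∃ k ∈ K, x * cs.simple j * x⁻¹ = cs.simple k}) :
    d * x ∈ minRight cs J := by
  intro j hj
  by_contra hlt
  have hlt' : cs.length (d * x * cs.simple j) < cs.length (d * x) := by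
    have := cs.length_mul_simple_ne (d * x) j
    omega
  have hxj := hxJ j hj
  obtain h1 | ⟨-, hmem⟩ := exchange_mul cs hd x j hlt'
  · omega
  have hlen := length_mul_of_minimal cs hxK hmem
  rw [inv_mul_cancel_right] at hlen
  obtain ⟨k, hk, hjk⟩ := exists_simple_of_length_eq_one cs hmem (by
    have := cs.length_mul_simple x j
    omega)
  exact hlt (h j ⟨hj, k, hk, hjk⟩)

/-! ### Reduction to distinguished form -/

theorem IJdw_subset (cs : CoxeterSystem M W) (J : Set I) (δ : I ≃ I) (w : W) :
    IJdw cs J δ w ⊆ J :=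
  Set.sUnion_subset fun _ hK => hK.1

theorem IJdw_mono (cs : CoxeterSystem M W) {J J' : Set I} (h : J ⊆ J') (δ : I ≃ I) (w : W) :
    IJdw cs J δ w ⊆ IJdw cs J' δ w :=
  Set.sUnion_subset_sUnion fun _ hK => ⟨hK.1.trans h, hK.2⟩

theorem toRel_mono (cs : CoxeterSystem M W) {J J' : Set I} (h : J ⊆ J') (δ : I ≃ I) {w w' : W}
    (hw : toRel cs J δ w w') : toRel cs J' δ w w' :=
  Relation.ReflTransGen.mono (fun _ _ ⟨j, hj, hs⟩ => ⟨j, h hj, hs⟩) _ _ hw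

/-- Every `w` can be reduced to an element `u * x` with `u ∈ W_{δ(J)}` and `x` a minimal length
representative of a `(W_{δ(J)}, W_J)` double coset. -/
theorem exists_toRel_mul_minimal (cs : CoxeterSystem M W) (J : Set I) (δ : I ≃ I) (w : W) :
    ∃ u ∈ parabolic cs (δ '' J), ∃ x ∈ minRight cs J,
      (∀ v ∈ parabolic cs (δ '' J), cs.length x ≤ cs.length (v * x)) ∧
      toRel cs J δ w (u * x) := by
  classical
  have hex : ∃ n, ∃ u ∈ parabolic cs (δ '' J), ∃ x, cs.length x = n ∧ toRel cs J δ w (u * x) :=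
    ⟨_, 1, one_mem _, w, rfl, by rw [one_mul]; exact Relation.ReflTransGen.refl⟩
  obtain ⟨u, hu, x, hxn, hrel⟩ := Nat.find_spec hex
  have hmin : ∀ u' ∈ parabolic cs (δ '' J), ∀ x', toRel cs J δ w (u' * x') →
      cs.length x ≤ cs.length x' := fun u' hu' x' hr =>
    hxn.trans_le (Nat.find_min' hex ⟨u', hu', x', rfl, hr⟩)
  have hcoset : ∀ v ∈ parabolic cs (δ '' J), cs.length x ≤ cs.length (v * x) := fun v hv =>
    hmin (u * v⁻¹) (mul_mem hu (inv_mem hv)) (v * x) (by simpa [mul_assoc] using hrel)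
  refine ⟨u, hu, x, fun j hj => ?_, hcoset, hrel⟩
  by_contra hlt
  have hδj := simple_mem_parabolic cs (Set.mem_image_of_mem δ hj)
  have hstep : stepTo cs J δ (u * x) (cs.simple (δ j) * u * (x * cs.simple j)) := by
    refine ⟨j, hj, by simp only [mul_assoc], ?_⟩
    have h1 := cs.length_mul_le (cs.simple (δ j) * u) (x * cs.simple j)
    have h2 := cs.length_mul_le (cs.simple (δ j)) u
    have h3 := cs.length_simple (δ j)
    have h4 := length_mul_of_minimal cs hcoset hu
    have h5 := cs.length_mul_simple x j
    omega
  have := hmin _ (mul_mem hδj hu) _ (hrel.tail hstep)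
  have := cs.length_mul_simple_ne x j
  omega

/-- If conjugation by `x` maps every `s_j`, `j ∈ J`, into `{s_k : k ∈ δ(J)}`, then
`Ad(x)(J) = δ(J)`. -/
theorem AdSet_eq_image (cs : CoxeterSystem M W) {J : Set I} (hJ : J.Finite) (δ : I ≃ I) (x : W)
    (h : ∀ j ∈ J, ∃ k ∈ δ '' J, x * cs.simple j * x⁻¹ = cs.simple k) :
    AdSet cs x J = δ '' J := by
  have hsub : AdSet cs x J ⊆ δ '' J := by
    rintro k ⟨j, hj, hk⟩
    obtain ⟨k', hk', he⟩ := h j hj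
    rwa [simple_injective cs (hk.trans he)]
  refine Set.eq_of_subset_of_ncard_le hsub ?_ (hJ.image δ)
  rw [Set.ncard_image_of_injective J δ.injective]
  classical
  refine (Set.ncard_le_ncard_of_injOn (fun j => if hj : j ∈ J then (h j hj).choose else j)
    ?_ ?_ ((hJ.image δ).subset hsub))
  · intro j hj
    simp only [hj, dite_true]
    exact ⟨j, hj, (h j hj).choose_spec.2.symm⟩
  · intro j hj j' hj' he
    simp only [hj, hj', dite_true] at he
    have := (h j hj).choose_spec.2.trans
      ((congrArg cs.simple he).trans (h j' hj').choose_spec.2.symm)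
    exact simple_injective cs (mul_left_cancel (mul_right_cancel this))

theorem exists_distinguished_form [Finite I] (cs : CoxeterSystem M W) (δ : I ≃ I)
    (J : Set I) (w : W) :
    ∃ w₁ ∈ minRight cs J, ∃ v ∈ parabolic cs (IJdw cs J δ w₁), toRel cs J δ w (w₁ * v) := by
  induction hn : J.ncard using Nat.strong_induction_on generalizing J w with
  | _ n ih =>
  subst hn
  obtain ⟨u, hu, x, hxJ, hxmin, hrel⟩ := exists_toRel_mul_minimal cs J δ w
  set J₁ : Set I := {j ∈ J | ∃ k ∈ δ '' J, x * cs.simple j * x⁻¹ = cs.simple k} with hJ₁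
  have hJ₁J : J₁ ⊆ J := Set.sep_subset _ _
  have hconj : ∀ v ∈ parabolic cs J₁, x * v * x⁻¹ ∈ parabolic cs (δ '' J) := by
    have hle : parabolic cs J₁ ≤ (parabolic cs (δ '' J)).comap (MulAut.conj x).toMonoidHom := by
      rw [parabolic, Subgroup.closure_le]
      rintro _ ⟨j, ⟨-, k, hk, hjk⟩, rfl⟩
      simpa [hjk] using simple_mem_parabolic cs hk
    exact fun v hv => by simpa using hle hv
  obtain hlt | hle := lt_or_ge J₁.ncard J.ncard
  · obtain ⟨w₁, hw₁, v, hv, hr⟩ := ih _ hlt J₁ (u * x) rfl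
    have hinv : ∀ y, toRel cs J₁ δ (u * x) y → y * x⁻¹ ∈ parabolic cs (δ '' J) := by
      intro y hy
      induction hy with
      | refl => simpa using hu
      | tail _ hs ihy =>
        obtain ⟨j, hj, rfl, -⟩ := hs
        have := mul_mem (mul_mem (simple_mem_parabolic cs (Set.mem_image_of_mem δ (hJ₁J hj))) ihy)
          (hconj _ (simple_mem_parabolic cs hj))
        simpa [mul_assoc] using this
    have hd : w₁ * x⁻¹ ∈ parabolic cs (δ '' J) := by
      have := mul_mem (hinv _ hr)
        (hconj _ (inv_mem (parabolic_mono cs (IJdw_subset cs J₁ δ w₁) hv)))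
      simpa [mul_assoc] using this
    refine ⟨w₁, ?_, v, parabolic_mono cs (IJdw_mono cs hJ₁J δ w₁) hv,
      hrel.trans (toRel_mono cs hJ₁J δ hr)⟩
    have := mul_mem_minRight cs hxmin hxJ hd (by rwa [inv_mul_cancel_right])
    rwa [inv_mul_cancel_right] at this
  · have hJe : J₁ = J := Set.eq_of_subset_of_ncard_le hJ₁J hle
    have hAd : AdSet cs x J = δ '' J :=
      AdSet_eq_image cs J.toFinite δ x fun j hj => (hJe.symm.subset hj).2
    have hle : parabolic cs (δ '' J) ≤
        (parabolic cs J).comap (MulAut.conj x⁻¹).toMonoidHom := by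
      rw [parabolic, Subgroup.closure_le]
      rintro _ ⟨k, hk, rfl⟩
      rw [← hAd] at hk
      obtain ⟨j, hj, hkj⟩ := hk
      simpa [hkj, mul_assoc] using simple_mem_parabolic cs hj
    have hJsub : J ⊆ IJdw cs J δ x := Set.subset_sUnion_of_mem ⟨subset_rfl, hAd⟩
    refine ⟨x, hxJ, x⁻¹ * u * x, parabolic_mono cs hJsub (by simpa using hle hu), ?_⟩
    simpa [mul_assoc] using hrel

/-- for every `w ∈ W` there exist `w₁ ∈ W^J` and `v ∈ W_{I(J,δ;w₁)}`
with `w →_{J,δ} w₁ v`. -/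
theorem to_distinguished_form
    [Fintype I] [Finite W]
    (cs : CoxeterSystem M W) (J : Set I) (δ : I ≃ I)
    (hδM : ∀ i j : I, M (δ i) (δ j) = M i j)
    (w : W) :
    ∃ w₁ ∈ minRight cs J, ∃ v ∈ parabolic cs (IJdw cs J δ w₁),
      toRel cs J δ w (w₁ * v) := by
  exact exists_distinguished_form cs δ J w

end HePaper
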